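/- arXiv:1205.1242 — 3 statements merged into one kernel-verified Lean document; each statement's English description precedes it below -/
import Mathlib

section
/- For any general source X = {X^n}, any sequence of positive reals {η_n}, and any sequence of positive reals {z_n}, for each n there exists an injective variable-length encoder φ_n : 𝒳^n → 𝒰* satisfying the cost Kraft inequality such that the overflow probability satisfies ε_n(φ_n, η_n) < Pr{ z_n · P_{X^n}(X^n) ≤ K^{−α_c η_n} } + z_n · K^{α_c c_max + 1}. -/
open scoped BigOperators

/-- Cost of a string `l` over the code alphabet `Fin K`: the sum of the conditional
per-symbol costs `c (l.get i) (prefix before position i)`. -/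
noncomputable def strCost {K : ℕ} (c : Fin K → List (Fin K) → ℝ) (l : List (Fin K)) : ℝ :=
  ∑ i : Fin l.length, c (l.get i) (l.take i.val)

/-- Probability of the set `S` under the probability mass function `P`. -/
noncomputable def prSet {α : Type*} (P : α → ℝ) (S : Set α) : ℝ :=
  ∑' x, S.indicator P x

theorem strCost_append_singleton {K : ℕ} (c : Fin K → List (Fin K) → ℝ)
    (l : List (Fin K)) (u : Fin K) : strCost c (l ++ [u]) = strCost c l + c u l := by
  have h : l.length + 1 = (l ++ [u]).length := by simp
  unfold strCost
  rw [← Equiv.sum_comp (finCongr h), Fin.sum_univ_castSucc]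
  congr 1
  · refine Finset.sum_congr rfl fun i _ => ?_
    simp [List.take_append_of_le_length i.2.le]
  · simp

/-- A weight on strings that is additive over one-symbol extensions and shrinks at a controlled
rate can be cut at any level `t`: below a string `s` of weight at least `t` there is a finite set of
extensions with total weight `q s`, each of weight in `[t, t / β)`. -/
theorem exists_finset_extensions_weight_eq {K : ℕ} {q : List (Fin K) → ℝ} {β ρ t : ℝ}
    (hβ : 0 < β) (hρ : 0 ≤ ρ)
    (hsum : ∀ s, ∑ u, q (s ++ [u]) = q s) (hlow : ∀ s u, β * q s ≤ q (s ++ [u]))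
    (hup : ∀ s u, q (s ++ [u]) ≤ ρ * q s) (N : ℕ) (s : List (Fin K))
    (hs : t ≤ q s) (hN : ρ ^ N * q s < t / β) :
    ∃ F : Finset (List (Fin K)),
      (∀ l ∈ F, s <+: l ∧ t ≤ q l ∧ q l < t / β) ∧ ∑ l ∈ F, q l = q s := by
  induction N generalizing s with
  | zero => exact ⟨{s}, by simpa using ⟨hs, by simpa using hN⟩, by simp⟩
  | succ N ih =>
    by_cases hlt : q s < t / β
    · exact ⟨{s}, by simpa using ⟨hs, hlt⟩, by simp⟩
    have hge : t ≤ β * q s := by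
      rw [not_lt, div_le_iff₀ hβ] at hlt
      linarith
    have hstep (u : Fin K) := ih (s ++ [u]) (hge.trans (hlow s u)) (by
      refine lt_of_le_of_lt ?_ hN
      calc ρ ^ N * q (s ++ [u]) ≤ ρ ^ N * (ρ * q s) := by gcongr; exact hup s u
        _ = ρ ^ (N + 1) * q s := by ring)
    choose F hF hFs using hstep
    refine ⟨Finset.univ.biUnion F, fun l hl => ?_, ?_⟩
    · obtain ⟨u, -, hu⟩ := Finset.mem_biUnion.1 hl
      exact ⟨(List.prefix_append s [u]).trans (hF u l hu).1, (hF u l hu).2⟩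
    · rw [Finset.sum_biUnion, Finset.sum_congr rfl fun u _ => hFs u, hsum]
      intro u _ v _ huv
      refine Finset.disjoint_left.2 fun l hu hv => huv ?_
      have := List.prefix_of_prefix_length_le (hF u l hu).1 (hF v l hv).1 (by simp)
      simpa using this.eq_of_length (by simp)

/-- With such a weight, any finite set `B` with `B.card * t < β` can be encoded by strings of weight
at least `t`, within an injective encoder satisfying the Kraft inequality. -/
theorem exists_injective_kraft_encoder {K : ℕ} [NeZero K] {q : List (Fin K) → ℝ} {β ρ t : ℝ}
    (hβ : 0 < β) (hβ₁ : β < 1) (hρ : 0 ≤ ρ) (hρ₁ : ρ < 1) (ht : 0 < t)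
    (hq : ∀ s, 0 < q s) (hnil : q [] = 1)
    (hsum : ∀ s, ∑ u, q (s ++ [u]) = q s) (hlow : ∀ s u, β * q s ≤ q (s ++ [u]))
    (hup : ∀ s u, q (s ++ [u]) ≤ ρ * q s)
    {α : Type*} [Countable α] (B : Finset α) (hB : B.card * t < β) :
    ∃ φ : α → List (Fin K), Function.Injective φ ∧ (∀ x, φ x ≠ []) ∧
      ∑' x, ENNReal.ofReal (q (φ x)) ≤ 1 ∧ ∀ x ∈ B, t ≤ q (φ x) := by
  classical
  obtain ⟨G, hGcard, hGsum, hG, hGnil⟩ : ∃ G : Finset (List (Fin K)), G.card = B.card ∧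
      ∑ l ∈ G, q l < 1 ∧ (∀ l ∈ G, t ≤ q l) ∧ [] ∉ G := by
    rcases B.eq_empty_or_nonempty with rfl | hne
    · exact ⟨∅, by simp⟩
    have htβ : t < β := by
      have : (1 : ℝ) ≤ B.card := by exact_mod_cast hne.card_pos
      nlinarith
    obtain ⟨N, hN⟩ := exists_pow_lt_of_lt_one (div_pos ht hβ) hρ₁
    obtain ⟨F, hF, hFs⟩ := exists_finset_extensions_weight_eq hβ (t := t) hρ hsum hlow hup N []
      (by rw [hnil]; linarith) (by simpa [hnil] using hN)
    have hcard : B.card < F.card := by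
      have h1 : (1 : ℝ) ≤ F.card * (t / β) := by
        rw [← hnil, ← hFs, ← nsmul_eq_mul]
        exact Finset.sum_le_card_nsmul _ _ _ fun l hl => (hF l hl).2.2.le
      have h2 : (B.card : ℝ) * t < F.card * t := by
        rw [← mul_div_assoc, le_div_iff₀ hβ] at h1
        linarith
      exact_mod_cast lt_of_mul_lt_mul_right h2 ht.le
    obtain ⟨G, hGF, hGc⟩ := Finset.exists_subset_card_eq hcard.le
    refine ⟨G, hGc, ?_, fun l hl => (hF l (hGF hl)).2.1, fun h => ?_⟩
    · obtain ⟨l, hl, hlG⟩ := Finset.exists_mem_notMem_of_card_lt_card (hGc ▸ hcard)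
      rw [← hnil, ← hFs]
      exact Finset.sum_lt_sum_of_subset hGF hl hlG (hq l) fun l _ _ => (hq l).le
    · have := (hF [] (hGF h)).2.2
      rw [hnil, lt_div_iff₀ hβ] at this
      linarith
  let e : B ≃ G := Finset.equivOfCardEq hGcard.symm
  obtain ⟨f, hf⟩ := exists_injective_nat α
  obtain ⟨L, hL, hLpos⟩ : ∃ L : ℕ, ρ ^ L * (1 - ρ)⁻¹ < 1 - ∑ l ∈ G, q l ∧
      G.sup List.length < L := by
    have hlim : Filter.Tendsto (fun L : ℕ => ρ ^ L * (1 - ρ)⁻¹) Filter.atTop (nhds 0) := by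
      simpa using (tendsto_pow_atTop_nhds_zero_of_lt_one hρ hρ₁).mul_const (1 - ρ)⁻¹
    exact ((hlim.eventually_lt_const (sub_pos.2 hGsum)).and
      (Filter.eventually_gt_atTop _)).exists
  have hrep (k : ℕ) : q (List.replicate k 0) ≤ ρ ^ k := by
    induction k with
    | zero => simp [hnil]
    | succ k ih =>
      rw [List.replicate_succ', pow_succ']
      exact (hup _ _).trans (by gcongr)
  have hlen (x : B) (k : ℕ) : (e x : List (Fin K)) ≠ List.replicate (k + L) 0 := by
    intro h
    have := Finset.le_sup (f := List.length) (e x).2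
    rw [h, List.length_replicate] at this
    omega
  let φ : α → List (Fin K) := fun x =>
    if h : x ∈ B then e ⟨x, h⟩ else List.replicate (f x + L) 0
  have hφB (x : B) : φ x = e x := dif_pos x.2
  have hφ (x : α) (h : x ∉ B) : φ x = List.replicate (f x + L) 0 := dif_neg h
  refine ⟨φ, fun x y hxy => ?_, fun x => ?_, ?_, fun x hx => ?_⟩
  · by_cases hx : x ∈ B <;> by_cases hy : y ∈ B
    · rw [hφB ⟨x, hx⟩, hφB ⟨y, hy⟩] at hxy
      simpa using e.injective (Subtype.ext hxy)
    · rw [hφB ⟨x, hx⟩, hφ y hy] at hxy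
      exact (hlen _ _ hxy).elim
    · rw [hφ x hx, hφB ⟨y, hy⟩] at hxy
      exact (hlen _ _ hxy.symm).elim
    · rw [hφ x hx, hφ y hy] at hxy
      have := congrArg List.length hxy
      simp only [List.length_replicate] at this
      exact hf (by omega)
  · by_cases hx : x ∈ B
    · rw [hφB ⟨x, hx⟩]
      exact fun h => hGnil (h ▸ (e ⟨x, hx⟩).2)
    · rw [hφ x hx]
      simp only [ne_eq, List.replicate_eq_nil_iff]
      omega
  · have hsumB : ∑ x ∈ B, q (φ x) = ∑ l ∈ G, q l := by
      rw [← Finset.sum_coe_sort B, ← Finset.sum_coe_sort G, ← e.sum_comp]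
      exact Finset.sum_congr rfl fun x _ => by rw [hφB]
    have hgeom : HasSum (fun k : ℕ => ρ ^ (k + L)) (ρ ^ L * (1 - ρ)⁻¹) := by
      simpa [pow_add, mul_comm] using (hasSum_geometric_of_lt_one hρ hρ₁).mul_left (ρ ^ L)
    calc ∑' x, ENNReal.ofReal (q (φ x))
        ≤ ∑' x, ((B : Set α).indicator (fun x => ENNReal.ofReal (q (φ x))) x
            + ENNReal.ofReal (ρ ^ (f x + L))) := by
          refine ENNReal.tsum_le_tsum fun x => ?_
          by_cases hx : x ∈ B
          · simp [hx]
          · rw [hφ x hx]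
            simpa [hx] using ENNReal.ofReal_le_ofReal (hrep (f x + L))
      _ = ENNReal.ofReal (∑ x ∈ B, q (φ x)) + ∑' x, ENNReal.ofReal (ρ ^ (f x + L)) := by
          rw [ENNReal.tsum_add, ENNReal.ofReal_sum_of_nonneg fun x _ => (hq _).le,
            ← Finset.tsum_subtype, ← tsum_subtype]
          rfl
      _ ≤ ENNReal.ofReal (∑ l ∈ G, q l) + ∑' k : ℕ, ENNReal.ofReal (ρ ^ (k + L)) := by
          rw [hsumB]
          gcongr
          exact ENNReal.tsum_comp_le_tsum_of_injective hf
            fun k : ℕ => ENNReal.ofReal (ρ ^ (k + L))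
      _ = ENNReal.ofReal (∑ l ∈ G, q l + ρ ^ L * (1 - ρ)⁻¹) := by
          rw [← ENNReal.ofReal_tsum_of_nonneg (fun k => pow_nonneg hρ _) hgeom.summable,
            hgeom.tsum_eq, ENNReal.ofReal_add (Finset.sum_nonneg fun l _ => (hq l).le)]
          exact mul_nonneg (pow_nonneg hρ _) (inv_nonneg.2 (by linarith))
      _ ≤ 1 := by
          rw [ENNReal.ofReal_le_one]
          linarith
  · rw [hφB ⟨x, hx⟩]
    exact hG _ (e _).2

theorem prSet_mono {α : Type*} {P : α → ℝ} (hP : ∀ x, 0 ≤ P x) (hs : Summable P)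
    {S T : Set α} (h : S ⊆ T) : prSet P S ≤ prSet P T :=
  Summable.tsum_le_tsum (Set.indicator_le_indicator_of_subset h hP)
    (hs.indicator S) (hs.indicator T)

/-- Lemma 1: for any general source, any sequence of positive thresholds `η n` and any
sequence of positive reals `z n`, for each `n` there is an injective prefix-cost
(Kraft-inequality) encoder whose overflow probability is bounded as stated. -/
theorem overflow_direct_bound
    (K : ℕ) (hK : 2 ≤ K)
    (c : Fin K → List (Fin K) → ℝ) (cmax αc : ℝ)
    (hcpos : ∀ (u : Fin K) (s : List (Fin K)), 0 < c u s)
    (hcmax : ∀ (u : Fin K) (s : List (Fin K)), c u s ≤ cmax)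
    (hαc : 0 < αc)
    (hcap : ∀ s : List (Fin K), ∑ u : Fin K, (K : ℝ) ^ (-(αc * c u s)) = 1)
    (𝓧 : Type) [Countable 𝓧]
    (P : (n : ℕ) → (Fin n → 𝓧) → ℝ)
    (hPnn : ∀ n x, 0 ≤ P n x) (hPsum : ∀ n, HasSum (P n) 1)
    (η z : ℕ → ℝ) (hη : ∀ n, 0 < η n) (hz : ∀ n, 0 < z n) (n : ℕ) :
    ∃ φ : (Fin n → 𝓧) → List (Fin K),
      Function.Injective φ ∧ (∀ x, φ x ≠ []) ∧
      (∑' x, ENNReal.ofReal ((K : ℝ) ^ (-(αc * strCost c (φ x)))) ≤ 1) ∧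
      prSet (P n) {x | strCost c (φ x) > η n}
        < prSet (P n) {x | z n * P n x ≤ (K : ℝ) ^ (-(αc * η n))}
          + z n * (K : ℝ) ^ (αc * cmax + 1) := by
  have : NeZero K := ⟨by omega⟩
  have hK₁ : (1 : ℝ) < K := by exact_mod_cast hK
  have hK₀ : (0 : ℝ) < K := by linarith
  set q : List (Fin K) → ℝ := fun s => (K : ℝ) ^ (-(αc * strCost c s)) with hqdef
  set β : ℝ := (K : ℝ) ^ (-(αc * cmax)) with hβdef
  set t : ℝ := (K : ℝ) ^ (-(αc * η n)) with htdef
  have hβ : 0 < β := Real.rpow_pos_of_pos hK₀ _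
  have ht : 0 < t := Real.rpow_pos_of_pos hK₀ _
  have hq (s) : 0 < q s := Real.rpow_pos_of_pos hK₀ _
  have hnil : q [] = 1 := by simp [hqdef, strCost]
  have happ (s) (u) : q (s ++ [u]) = (K : ℝ) ^ (-(αc * c u s)) * q s := by
    rw [hqdef]
    simp only
    rw [← Real.rpow_add hK₀, strCost_append_singleton]
    congr 1
    ring
  have hfac (u s) : β ≤ (K : ℝ) ^ (-(αc * c u s)) :=
    Real.rpow_le_rpow_of_exponent_le hK₁.le
      (neg_le_neg (mul_le_mul_of_nonneg_left (hcmax u s) hαc.le))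
  have hfac' (u s) : (K : ℝ) ^ (-(αc * c u s)) ≤ 1 - β := by
    have : Nontrivial (Fin K) := Fin.nontrivial_iff_two_le.2 hK
    obtain ⟨v, hv⟩ := exists_ne u
    have h := Finset.add_le_sum (f := fun u => (K : ℝ) ^ (-(αc * c u s)))
      (fun i _ => (Real.rpow_pos_of_pos hK₀ _).le) (Finset.mem_univ u) (Finset.mem_univ v) hv.symm
    rw [hcap s] at h
    linarith [hfac v s]
  have hβ₁ : β < 1 := by
    have := hfac' 0 []
    linarith [Real.rpow_pos_of_pos hK₀ (-(αc * c 0 []))]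
  have henc (B : Finset (Fin n → 𝓧)) (hB : B.card * t < β) :=
    exists_injective_kraft_encoder hβ hβ₁ (sub_nonneg.2 hβ₁.le) (sub_lt_self 1 hβ) ht hq hnil
      (fun s => by simp_rw [happ, ← Finset.sum_mul, hcap, one_mul])
      (fun s u => by
        simpa only [happ] using mul_le_mul_of_nonneg_right (hfac u s) (hq s).le)
      (fun s u => by
        simpa only [happ] using mul_le_mul_of_nonneg_right (hfac' u s) (hq s).le) B hB
  have hconst : (K : ℝ) ^ (αc * cmax + 1) = K / β := by
    rw [Real.rpow_add hK₀, Real.rpow_one, hβdef, Real.rpow_neg hK₀.le]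
    field_simp
  rw [hconst]
  by_cases hzβ : z n ≤ β / K
  · have hfin : {x | t < z n * P n x}.Finite := by
      have hlim := ((hPsum n).summable.mul_left (z n)).tendsto_cofinite_zero
      simpa [Filter.eventually_cofinite] using hlim.eventually_le_const ht
    have hB : hfin.toFinset.card * t < β := by
      calc (hfin.toFinset.card : ℝ) * t ≤ ∑ x ∈ hfin.toFinset, z n * P n x := by
            rw [← nsmul_eq_mul]
            exact Finset.card_nsmul_le_sum _ _ _ fun x hx => (hfin.mem_toFinset.1 hx).le
        _ ≤ z n * 1 := sum_le_hasSum _ (fun x _ => mul_nonneg (hz n).le (hPnn n x))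
            ((hPsum n).mul_left (z n))
        _ ≤ β / K := by rwa [mul_one]
        _ < β := div_lt_self hβ hK₁
    obtain ⟨φ, hinj, hne, hkraft, hφ⟩ := henc _ hB
    refine ⟨φ, hinj, hne, hkraft, ?_⟩
    refine lt_of_le_of_lt (prSet_mono (hPnn n) (hPsum n).summable fun x hx => ?_)
      (lt_add_of_pos_right _ (mul_pos (hz n) (div_pos hK₀ hβ)))
    by_contra hx'
    have hlt : t < z n * P n x := lt_of_not_ge hx'
    have h := hφ x (hfin.mem_toFinset.2 hlt)
    rw [htdef, hqdef, Real.rpow_le_rpow_left_iff hK₁, neg_le_neg_iff,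
      mul_le_mul_iff_right₀ hαc] at h
    exact absurd hx (not_lt.2 h)
  · obtain ⟨φ, hinj, hne, hkraft, -⟩ := henc ∅ (by simpa using hβ)
    refine ⟨φ, hinj, hne, hkraft, ?_⟩
    have h1 : prSet (P n) {x | strCost c (φ x) > η n} ≤ 1 := by
      refine (prSet_mono (hPnn n) (hPsum n).summable (Set.subset_univ _)).trans_eq ?_
      simpa [prSet] using (hPsum n).tsum_eq
    have h2 : 0 ≤ prSet (P n) {x | z n * P n x ≤ t} :=
      tsum_nonneg fun x => Set.indicator_nonneg (fun x _ => hPnn n x) x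
    have h3 : 1 < z n * (K / β) := by
      rw [not_le, div_lt_iff₀ hK₀] at hzβ
      rwa [← mul_div_assoc, one_lt_div hβ]
    linarith
end

section
/- For any general source X = {X^n}, any variable-length encoder φ_n : 𝒳^n → 𝒰* satisfying the cost Kraft inequality, any positive real η_n, and any positive real z_n, the overflow probability satisfies ε_n(φ_n, η_n) ≥ Pr{ P_{X^n}(X^n) ≤ z_n · K^{−α_c η_n} } − z_n. -/
open scoped BigOperators

theorem summable_and_tsum_le_one_of_tsum_ofReal_le_one {α : Type*} {g : α → ℝ}
    (hg : ∀ x, 0 ≤ g x) (h : ∑' x, ENNReal.ofReal (g x) ≤ 1) :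
    Summable g ∧ ∑' x, g x ≤ 1 := by
  have hs : Summable g := by
    simpa only [ENNReal.toReal_ofReal (hg _)] using
      ENNReal.summable_toReal (ne_top_of_le_ne_top ENNReal.one_ne_top h)
  refine ⟨hs, ?_⟩
  rwa [← ENNReal.ofReal_tsum_of_nonneg hg hs, ENNReal.ofReal_le_one] at h

/-- Lemma 2: for any general source, any variable-length encoder satisfying the cost
Kraft inequality, any positive threshold `η n` and any positive real `z n`, the
overflow probability is lower bounded as stated. -/
theorem overflow_converse_bound
    (K : ℕ) (hK : 2 ≤ K)
    (c : Fin K → List (Fin K) → ℝ) (cmax αc : ℝ)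
    (hcpos : ∀ (u : Fin K) (s : List (Fin K)), 0 < c u s)
    (hcmax : ∀ (u : Fin K) (s : List (Fin K)), c u s ≤ cmax)
    (hαc : 0 < αc)
    (hcap : ∀ s : List (Fin K), ∑ u : Fin K, (K : ℝ) ^ (-(αc * c u s)) = 1)
    (𝓧 : Type) [Countable 𝓧]
    (P : (n : ℕ) → (Fin n → 𝓧) → ℝ)
    (hPnn : ∀ n x, 0 ≤ P n x) (hPsum : ∀ n, HasSum (P n) 1)
    (n : ℕ) (φ : (Fin n → 𝓧) → List (Fin K))
    (hne : ∀ x, φ x ≠ [])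
    (hkraft : ∑' x, ENNReal.ofReal ((K : ℝ) ^ (-(αc * strCost c (φ x)))) ≤ 1)
    (ηn zn : ℝ) (hη : 0 < ηn) (hz : 0 < zn) :
    prSet (P n) {x | strCost c (φ x) > ηn}
      ≥ prSet (P n) {x | P n x ≤ zn * (K : ℝ) ^ (-(αc * ηn))} - zn := by
  have hK1 : (1 : ℝ) ≤ K := by exact_mod_cast (by omega : 1 ≤ K)
  obtain ⟨hgs, hgle⟩ := summable_and_tsum_le_one_of_tsum_ofReal_le_one
    (fun x => Real.rpow_nonneg (Nat.cast_nonneg K) (-(αc * strCost c (φ x)))) hkraft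
  have hPs : Summable (P n) := (hPsum n).summable
  have hbound := Summable.tsum_le_tsum
    (f := {x | P n x ≤ zn * (K : ℝ) ^ (-(αc * ηn))}.indicator (P n))
    (g := fun x => {x | strCost c (φ x) > ηn}.indicator (P n) x
      + zn * (K : ℝ) ^ (-(αc * strCost c (φ x))))
    (fun x => by
      have hg : 0 ≤ zn * (K : ℝ) ^ (-(αc * strCost c (φ x))) := by positivity
      have hP := hPnn n x
      by_cases hover : strCost c (φ x) > ηn
      · rw [Set.indicator_of_mem (s := {x | strCost c (φ x) > ηn}) hover]
        exact (Set.indicator_le_self' (fun _ _ => hPnn n _) x).trans (by linarith)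
      · rw [Set.indicator_of_notMem (s := {x | strCost c (φ x) > ηn}) hover, zero_add]
        refine Set.indicator_apply_le' (fun hx => hx.trans ?_) (fun _ => hg)
        have := mul_le_mul_of_nonneg_left (not_lt.mp hover) hαc.le
        gcongr)
    (hPs.indicator _) ((hPs.indicator _).add (hgs.mul_left zn))
  rw [(hPs.indicator _).tsum_add (hgs.mul_left zn), tsum_mul_left] at hbound
  have := mul_le_mul_of_nonneg_left hgle hz.le
  unfold prSet
  linarith
end

section
/- (Converse part.) For every ε with 0 ≤ ε < 1 and every general source X, no real number R_1 with R_1 < inf{ R : F(R) ≤ ε } is an ε-achievable threshold; consequently R(ε|X) ≥ inf{ R : F(R) ≤ ε }, where F(R) = limsup_{n→∞} Pr{ (1/(n α_c)) log_K (1/P_{X^n}(X^n)) ≥ R }. -/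
open scoped BigOperators

lemma prSet_nonneg {α : Type*} {P : α → ℝ} (hP : ∀ x, 0 ≤ P x) (S : Set α) :
    0 ≤ prSet P S :=
  tsum_nonneg fun _ => Set.indicator_nonneg (fun x _ => hP x) _

lemma prSet_mono_of_ne_zero {α : Type*} {P : α → ℝ} (hP : ∀ x, 0 ≤ P x) (hs : Summable P)
    {S T : Set α} (h : ∀ x ∈ S, P x ≠ 0 → x ∈ T) : prSet P S ≤ prSet P T := by
  refine Summable.tsum_le_tsum (fun x => ?_) (hs.indicator S) (hs.indicator T)
  by_cases hx : x ∈ S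
  · by_cases h0 : P x = 0
    · simp [Set.indicator, h0]
    · simp [hx, h x hx h0]
  · rw [Set.indicator_of_notMem hx]
    exact Set.indicator_nonneg (fun x _ => hP x) _

lemma prSet_univ {α : Type*} {P : α → ℝ} (hs : HasSum P 1) : prSet P Set.univ = 1 := by
  simp [prSet, hs.tsum_eq]

lemma prSet_le_one {α : Type*} {P : α → ℝ} (hP : ∀ x, 0 ≤ P x) (hs : HasSum P 1)
    (S : Set α) : prSet P S ≤ 1 :=
  (prSet_mono_of_ne_zero hP hs.summable fun _ _ _ => Set.mem_univ _).trans_eq (prSet_univ hs)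

/-- If `P` is dominated by `r • w` on `S \ T`, where `w` has total mass at most one, then
passing from `T` to `S` increases the probability by at most `r`. -/
lemma prSet_le_add_of_le_mul {α : Type*} {P w : α → ℝ} (hP : ∀ x, 0 ≤ P x) (hs : Summable P)
    (hw : ∀ x, 0 ≤ w x) (hw1 : ∑' x, ENNReal.ofReal (w x) ≤ 1) {r : ℝ} (hr : 0 ≤ r)
    {S T : Set α} (h : ∀ x ∈ S, x ∉ T → P x ≠ 0 → P x ≤ r * w x) :
    prSet P S ≤ prSet P T + r := by
  have hws : Summable w := by
    have := ENNReal.summable_toReal (hw1.trans_lt ENNReal.one_lt_top).ne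
    simpa [ENNReal.toReal_ofReal (hw _)] using this
  have hw1' : ∑' x, w x ≤ 1 := by
    rw [← ENNReal.ofReal_tsum_of_nonneg hw hws] at hw1
    exact ENNReal.ofReal_le_one.mp hw1
  calc prSet P S ≤ ∑' x, (T.indicator P x + r * w x) := by
        refine Summable.tsum_le_tsum (fun x => ?_) (hs.indicator S)
          ((hs.indicator T).add (hws.mul_left r))
        have hrw := mul_nonneg hr (hw x)
        have hT : 0 ≤ T.indicator P x := Set.indicator_nonneg (fun x _ => hP x) _
        by_cases hx : x ∈ S
        · rw [Set.indicator_of_mem hx]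
          by_cases hxT : x ∈ T
          · rw [Set.indicator_of_mem hxT]; linarith
          · by_cases h0 : P x = 0
            · rw [h0]; linarith
            · linarith [h x hx hxT h0]
        · rw [Set.indicator_of_notMem hx]; linarith
    _ = prSet P T + r * ∑' x, w x := by
        rw [Summable.tsum_add (hs.indicator T) (hws.mul_left r), tsum_mul_left]; rfl
    _ ≤ prSet P T + r := by nlinarith

lemma limsup_le_of_le_add_tendsto_zero {f g h : ℕ → ℝ} {ε : ℝ} (hf : ∀ n, 0 ≤ f n)
    (hg : ∀ n, g n ≤ 1) (hh : Filter.Tendsto h Filter.atTop (nhds 0))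
    (hle : ∀ᶠ n in Filter.atTop, f n ≤ g n + h n)
    (hgε : Filter.limsup g Filter.atTop ≤ ε) : Filter.limsup f Filter.atTop ≤ ε := by
  refine le_of_forall_pos_le_add fun δ hδ => ?_
  have h1 : ∀ᶠ n in Filter.atTop, g n < ε + δ / 2 :=
    Filter.eventually_lt_of_limsup_lt (by linarith)
      (Filter.isBoundedUnder_of ⟨1, hg⟩)
  have h2 : ∀ᶠ n in Filter.atTop, h n < δ / 2 := hh.eventually_lt_const (by linarith)
  refine Filter.limsup_le_of_le
    (Filter.IsBoundedUnder.isCoboundedUnder_le (Filter.isBoundedUnder_of ⟨0, hf⟩)) ?_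
  filter_upwards [h1, h2, hle] with n a b d
  linarith

lemma strCost_replicate {K : ℕ} (c : Fin K → List (Fin K) → ℝ) (u : Fin K) (n : ℕ) :
    strCost c (List.replicate n u) =
      ∑ i ∈ Finset.range n, c u (List.replicate i u) := by
  have h : strCost c (List.replicate n u) = ∑ i : Fin (List.replicate n u).length,
      (fun i : ℕ => c u (List.replicate i u)) i := by
    refine Finset.sum_congr rfl fun i _ => ?_
    have hi : (i : ℕ) ≤ n := by simpa using i.2.le
    simp [List.take_replicate, hi]
  rw [h, ← Finset.sum_range (fun i : ℕ => c u (List.replicate i u)), List.length_replicate]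

/-- Under the capacity equation, bounded symbol costs are bounded away from zero. -/
lemma exists_pos_le_cost {K : ℕ} (hK : 2 ≤ K) {c : Fin K → List (Fin K) → ℝ} {cmax αc : ℝ}
    (hcmax : ∀ u s, c u s ≤ cmax) (hαc : 0 < αc)
    (hcap : ∀ s : List (Fin K), ∑ u : Fin K, (K : ℝ) ^ (-(αc * c u s)) = 1) :
    ∃ m > 0, ∀ u s, m ≤ c u s := by
  have hK1 : (1 : ℝ) < K := by exact_mod_cast hK
  have hK0 : (0 : ℝ) < K := by linarith
  set δ : ℝ := (K : ℝ) ^ (-(αc * cmax)) with hδ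
  have hδ0 : 0 < δ := Real.rpow_pos_of_pos hK0 _
  have hle : ∀ u s, (K : ℝ) ^ (-(αc * c u s)) ≤ 1 - δ := by
    intro u s
    obtain ⟨v, hv⟩ : ∃ v : Fin K, v ≠ u := by
      have : Nontrivial (Fin K) := Fin.nontrivial_iff_two_le.mpr hK
      exact exists_ne u
    have h1 : δ ≤ (K : ℝ) ^ (-(αc * c v s)) :=
      Real.rpow_le_rpow_of_exponent_le hK1.le
        (neg_le_neg (mul_le_mul_of_nonneg_left (hcmax v s) hαc.le))
    have h2 := Finset.sum_le_sum_of_subset_of_nonneg (Finset.subset_univ {v, u})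
      (f := fun u => (K : ℝ) ^ (-(αc * c u s)))
      fun i _ _ => (Real.rpow_pos_of_pos hK0 _).le
    rw [hcap, Finset.sum_pair hv] at h2
    linarith
  have h1δ : 0 < 1 - δ :=
    lt_of_lt_of_le (Real.rpow_pos_of_pos hK0 _) (hle ⟨0, by omega⟩ [])
  refine ⟨-Real.logb K (1 - δ) / αc, ?_, fun u s => ?_⟩
  · exact div_pos (neg_pos.mpr (Real.logb_neg hK1 h1δ (by linarith))) hαc
  · rw [div_le_iff₀ hαc]
    have := (Real.le_logb_iff_rpow_le hK1 h1δ).mpr (hle u s)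
    linarith

lemma exists_strCost_between {K : ℕ} (hK : 2 ≤ K) {c : Fin K → List (Fin K) → ℝ} {cmax αc : ℝ}
    (hcmax : ∀ u s, c u s ≤ cmax) (hαc : 0 < αc)
    (hcap : ∀ s : List (Fin K), ∑ u : Fin K, (K : ℝ) ^ (-(αc * c u s)) = 1)
    {T : ℝ} (hT : 0 ≤ T) :
    ∃ l : List (Fin K), l ≠ [] ∧ T ≤ strCost c l ∧ strCost c l ≤ T + cmax := by
  classical
  obtain ⟨m, hm, hmc⟩ := exists_pos_le_cost hK hcmax hαc hcap
  let u : Fin K := ⟨0, by omega⟩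
  have hex : ∃ n : ℕ, T ≤ strCost c (List.replicate (n + 1) u) := by
    obtain ⟨n, hn⟩ := exists_nat_ge (T / m)
    refine ⟨n, ?_⟩
    rw [strCost_replicate]
    have h1 := Finset.card_nsmul_le_sum (Finset.range (n + 1))
      (fun i => c u (List.replicate i u)) m fun i _ => hmc _ _
    rw [div_le_iff₀ hm] at hn
    simp only [Finset.card_range, nsmul_eq_mul, Nat.cast_add, Nat.cast_one] at h1
    linarith
  refine ⟨List.replicate (Nat.find hex + 1) u, by simp, Nat.find_spec hex, ?_⟩
  rw [strCost_replicate, Finset.sum_range_succ, ← strCost_replicate]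
  refine add_le_add ?_ (hcmax _ _)
  rcases h : Nat.find hex with _ | k
  · rw [strCost_replicate, Finset.sum_range_zero]
    exact hT
  · exact (not_le.mp (Nat.find_min hex (m := k) (by omega))).le

/-- A code satisfying the cost Kraft inequality whose cost exceeds the normalized
self-information by at most a constant. -/
lemma exists_kraft_code {K : ℕ} (hK : 2 ≤ K) {c : Fin K → List (Fin K) → ℝ} {cmax αc : ℝ}
    (hcmax : ∀ u s, c u s ≤ cmax) (hαc : 0 < αc)
    (hcap : ∀ s : List (Fin K), ∑ u : Fin K, (K : ℝ) ^ (-(αc * c u s)) = 1)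
    {α : Type*} [Countable α] {P : α → ℝ} (hP : ∀ x, 0 ≤ P x) (hs : HasSum P 1) :
    ∃ φ : α → List (Fin K), (∀ x, φ x ≠ []) ∧
      ∑' x, ENNReal.ofReal ((K : ℝ) ^ (-(αc * strCost c (φ x)))) ≤ 1 ∧
      ∀ x, P x ≠ 0 →
        strCost c (φ x) ≤ Real.logb K (1 / P x) / αc + (Real.logb K 2 / αc + cmax) := by
  have hK1 : (1 : ℝ) < K := by exact_mod_cast hK
  have hK0 : (0 : ℝ) < K := by linarith
  have := Encodable.ofCountable α
  obtain ⟨G, hG, s, hGs, hs1⟩ := posSumOfEncodable (zero_lt_one (α := ℝ)) α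
  set Q : α → ℝ := fun x => (P x + G x) / 2 with hQ
  have hQ0 : ∀ x, 0 < Q x := fun x => by have := hP x; have := hG x; simp only [hQ]; linarith
  have hQs : HasSum Q ((1 + s) / 2) := (hs.add hGs).div_const 2
  have hQ1 : ∀ x, Q x ≤ 1 := fun x => by
    have := le_hasSum hQs x fun y _ => (hQ0 y).le
    linarith
  have hT : ∀ x, 0 ≤ -Real.logb K (Q x) / αc := fun x =>
    div_nonneg (neg_nonneg.mpr (Real.logb_nonpos hK1 (hQ0 x).le (hQ1 x))) hαc.le
  choose φ hne hlo hhi using fun x => exists_strCost_between hK hcmax hαc hcap (hT x)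
  refine ⟨φ, hne, ?_, fun x hx => (hhi x).trans ?_⟩
  · calc ∑' x, ENNReal.ofReal ((K : ℝ) ^ (-(αc * strCost c (φ x))))
        ≤ ∑' x, ENNReal.ofReal (Q x) := by
          refine ENNReal.tsum_le_tsum fun x => ENNReal.ofReal_le_ofReal ?_
          rw [← Real.le_logb_iff_rpow_le hK1 (hQ0 x)]
          have := hlo x
          rw [div_le_iff₀ hαc] at this
          linarith
      _ ≤ 1 := by
          rw [← ENNReal.ofReal_tsum_of_nonneg (fun x => (hQ0 x).le) hQs.summable, hQs.tsum_eq]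
          exact ENNReal.ofReal_le_one.mpr (by linarith)
  · have hPx : 0 < P x := lt_of_le_of_ne (hP x) hx.symm
    have h1 : Real.logb K (P x / 2) ≤ Real.logb K (Q x) :=
      Real.logb_le_logb_of_le hK1 (by linarith) (by have := hG x; simp only [hQ]; linarith)
    rw [Real.logb_div hx two_ne_zero] at h1
    rw [one_div, Real.logb_inv, ← add_assoc, ← add_div]
    gcongr
    linarith

/-- Converse part of Theorem 1: no `R₁` below `inf { R | F(R) ≤ ε }` is an
`ε`-achievable overflow threshold; consequently `R(ε | X) ≥ inf { R | F(R) ≤ ε }`. -/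
theorem first_order_overflow_threshold_converse
    (K : ℕ) (hK : 2 ≤ K)
    (c : Fin K → List (Fin K) → ℝ) (cmax αc : ℝ)
    (hcpos : ∀ (u : Fin K) (s : List (Fin K)), 0 < c u s)
    (hcmax : ∀ (u : Fin K) (s : List (Fin K)), c u s ≤ cmax)
    (hαc : 0 < αc)
    (hcap : ∀ s : List (Fin K), ∑ u : Fin K, (K : ℝ) ^ (-(αc * c u s)) = 1)
    (𝓧 : Type) [Countable 𝓧]
    (P : (n : ℕ) → (Fin n → 𝓧) → ℝ)
    (hPnn : ∀ n x, 0 ≤ P n x) (hPsum : ∀ n, HasSum (P n) 1)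
    (ε : ℝ) (hε0 : 0 ≤ ε) (hε1 : ε < 1) :
    (∀ R₁ : ℝ, R₁ < sInf {R : ℝ |
        Filter.limsup
          (fun n : ℕ => prSet (P n)
            {x | (1 / ((n : ℝ) * αc)) * Real.logb K (1 / P n x) ≥ R})
          Filter.atTop ≤ ε} →
      ¬ ∃ φ : (n : ℕ) → (Fin n → 𝓧) → List (Fin K),
          (∀ n x, φ n x ≠ []) ∧
          (∀ n, ∑' x, ENNReal.ofReal ((K : ℝ) ^ (-(αc * strCost c (φ n x)))) ≤ 1) ∧
          Filter.limsup
            (fun n => prSet (P n) {x | strCost c (φ n x) > (n : ℝ) * R₁})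
            Filter.atTop ≤ ε) ∧
    sInf {R : ℝ |
        Filter.limsup
          (fun n : ℕ => prSet (P n)
            {x | (1 / ((n : ℝ) * αc)) * Real.logb K (1 / P n x) ≥ R})
          Filter.atTop ≤ ε}
      ≤ sInf {R : ℝ | ∃ φ : (n : ℕ) → (Fin n → 𝓧) → List (Fin K),
          (∀ n x, φ n x ≠ []) ∧
          (∀ n, ∑' x, ENNReal.ofReal ((K : ℝ) ^ (-(αc * strCost c (φ n x)))) ≤ 1) ∧
          Filter.limsup
            (fun n => prSet (P n) {x | strCost c (φ n x) > (n : ℝ) * R})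
            Filter.atTop ≤ ε} := by
  have hK1 : (1 : ℝ) < K := by exact_mod_cast hK
  have hK0 : (0 : ℝ) < K := by linarith
  set A := {R : ℝ | Filter.limsup
          (fun n : ℕ => prSet (P n)
            {x | (1 / ((n : ℝ) * αc)) * Real.logb K (1 / P n x) ≥ R})
          Filter.atTop ≤ ε} with hA
  have hApos : ∀ R ∈ A, 0 ≤ R := by
    intro R hR
    by_contra! hneg
    have h1 : ∀ n : ℕ, prSet (P n)
        {x | (1 / ((n : ℝ) * αc)) * Real.logb K (1 / P n x) ≥ R} = 1 := by
      intro n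
      refine le_antisymm (prSet_le_one (hPnn n) (hPsum n) _) ?_
      refine (prSet_univ (hPsum n)).ge.trans
        (prSet_mono_of_ne_zero (hPnn n) (hPsum n).summable fun x _ _ => ?_)
      have hx1 : P n x ≤ 1 := le_hasSum (hPsum n) x fun y _ => hPnn n y
      have hlog : 0 ≤ Real.logb K (1 / P n x) := by
        rw [one_div, Real.logb_inv]
        exact neg_nonneg.mpr (Real.logb_nonpos hK1 (hPnn n x) hx1)
      exact hneg.le.trans (mul_nonneg (by positivity) hlog)
    simp only [hA, Set.mem_ofPred_eq, h1, Filter.limsup_const] at hR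
    linarith
  have hbdd : BddBelow A := ⟨0, hApos⟩
  have key : ∀ R₁ : ℝ, (∃ φ : (n : ℕ) → (Fin n → 𝓧) → List (Fin K),
          (∀ n x, φ n x ≠ []) ∧
          (∀ n, ∑' x, ENNReal.ofReal ((K : ℝ) ^ (-(αc * strCost c (φ n x)))) ≤ 1) ∧
          Filter.limsup
            (fun n => prSet (P n) {x | strCost c (φ n x) > (n : ℝ) * R₁})
            Filter.atTop ≤ ε) → ∀ R, R₁ < R → R ∈ A := by
    rintro R₁ ⟨φ, -, hkraft, hover⟩ R hR
    have hd : 0 < αc * (R - R₁) := mul_pos hαc (by linarith)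
    have hb : (K : ℝ) ^ (-(αc * (R - R₁))) < 1 :=
      Real.rpow_lt_one_of_one_lt_of_neg hK1 (by linarith)
    have hb0 : 0 < (K : ℝ) ^ (-(αc * (R - R₁))) := Real.rpow_pos_of_pos hK0 _
    refine limsup_le_of_le_add_tendsto_zero (fun n => prSet_nonneg (hPnn n) _)
      (fun n => prSet_le_one (hPnn n) (hPsum n) _)
      (tendsto_pow_atTop_nhds_zero_of_lt_one hb0.le hb) ?_ hover
    filter_upwards [Filter.eventually_gt_atTop 0] with n hn
    have hn0 : (0 : ℝ) < n := by exact_mod_cast hn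
    refine prSet_le_add_of_le_mul (hPnn n) (hPsum n).summable
      (fun x => (Real.rpow_pos_of_pos hK0 _).le) (hkraft n) (pow_pos hb0 n).le
      fun x hx hxT h0 => ?_
    have hPx : 0 < P n x := lt_of_le_of_ne (hPnn n x) (Ne.symm h0)
    simp only [Set.mem_ofPred_eq, ge_iff_le, gt_iff_lt, not_lt] at hx hxT
    rw [one_div_mul_eq_div, le_div_iff₀ (by positivity), one_div, Real.logb_inv] at hx
    rw [← Real.rpow_mul_natCast hK0.le, ← Real.rpow_add hK0,
      ← Real.logb_le_iff_le_rpow hK1 hPx]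
    have := mul_le_mul_of_nonneg_left hxT hαc.le
    nlinarith
  refine ⟨fun R₁ hR₁ hach => ?_, ?_⟩
  · obtain ⟨R, h1, h2⟩ := exists_between hR₁
    exact absurd (csInf_le hbdd (key R₁ hach R h1)) (not_le.mpr h2)
  · rcases A.eq_empty_or_nonempty with hempty | ⟨R, hR⟩
    · rw [hempty, Real.sInf_empty]
      refine Real.sInf_nonneg fun R hach => ?_
      have := key R hach (R + 1) (by linarith)
      simp [hempty] at this
    · refine le_csInf ?_ fun R₁ hach => le_of_forall_gt_imp_ge_of_dense fun R' hR' =>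
        csInf_le hbdd (key R₁ hach R' hR')
      choose φ hne hkraft hcost using fun n =>
        exists_kraft_code hK hcmax hαc hcap (hPnn n) (hPsum n)
      have hcm : 0 < cmax := (hcpos ⟨0, by omega⟩ []).trans_le (hcmax _ _)
      have hd : 0 < Real.logb K 2 / αc + cmax :=
        add_pos (div_pos (Real.logb_pos hK1 one_lt_two) hαc) hcm
      set d := Real.logb K 2 / αc + cmax
      refine ⟨R + d, φ, hne, hkraft, ?_⟩
      refine limsup_le_of_le_add_tendsto_zero (fun n => prSet_nonneg (hPnn n) _)
        (fun n => prSet_le_one (hPnn n) (hPsum n) _) tendsto_const_nhds ?_ hR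
      filter_upwards [Filter.eventually_gt_atTop 0] with n hn
      have hn1 : (1 : ℝ) ≤ n := by exact_mod_cast hn
      rw [add_zero]
      refine prSet_mono_of_ne_zero (hPnn n) (hPsum n).summable fun x hx h0 => ?_
      simp only [Set.mem_ofPred_eq, ge_iff_le, gt_iff_lt] at hx ⊢
      have h1 := hcost n x h0
      have h2 : (n : ℝ) * R ≤ Real.logb K (1 / P n x) / αc := by nlinarith
      rw [one_div_mul_eq_div, le_div_iff₀ (by positivity)]
      rw [le_div_iff₀ hαc] at h2
      linarith
end
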